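/- Elimination of the dual substructure unknowns from the full FETI-DP system yields the saddle-point FETI-DP formulation: if vectors w_Δ, μ, u_c, λ and a vector g of size n satisfy the four equations S*w_Δ + Cᵀ*μ + S*Φ*u_c + Bᵀ*λ = g, C*w_Δ = 0, Φᵀ*S*w_Δ + Φᵀ*S*Φ*u_c + Φᵀ*Bᵀ*λ = Φᵀ*g, and B*w_Δ + B*Φ*u_c = 0, then S_c*u_c + Ψᵀ*Bᵀ*λ = Ψᵀ*g and B*Ψ*u_c − B*S_Δinv*Bᵀ*λ = −B*S_Δinv*g (the derivation of (eq:bddc-dp) from (eq:feti-dp-full) in the paper). -/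

import Mathlib

open Matrix

noncomputable section

/-- The saddle-point matrix `K = [[S, Cᵀ], [C, 0]]`. -/
def Kmat {n c : ℕ} (S : Matrix (Fin n) (Fin n) ℝ) (C : Matrix (Fin c) (Fin n) ℝ) :
    Matrix (Fin n ⊕ Fin c) (Fin n ⊕ Fin c) ℝ :=
  fromBlocks S Cᵀ C 0

/-- `S_Δ⁻¹`, the upper-left `n×n` block of `K⁻¹`. -/
def SDelta {n c : ℕ} (S : Matrix (Fin n) (Fin n) ℝ) (C : Matrix (Fin c) (Fin n) ℝ) :
    Matrix (Fin n) (Fin n) ℝ :=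
  ((Kmat S C)⁻¹).toBlocks₁₁

/-- The energy-minimal coarse basis `Ψ = (I − S_Δ⁻¹ S) Φ`. -/
def Psi {n c q : ℕ} (S : Matrix (Fin n) (Fin n) ℝ) (C : Matrix (Fin c) (Fin n) ℝ)
    (Φ : Matrix (Fin n) (Fin q) ℝ) : Matrix (Fin n) (Fin q) ℝ :=
  (1 - SDelta S C * S) * Φ

/-- The coarse matrix `S_c = Φᵀ S Φ − [S Φ; 0]ᵀ K⁻¹ [S Φ; 0]`. -/
def Sc {n c q : ℕ} (S : Matrix (Fin n) (Fin n) ℝ) (C : Matrix (Fin c) (Fin n) ℝ)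
    (Φ : Matrix (Fin n) (Fin q) ℝ) : Matrix (Fin q) (Fin q) ℝ :=
  Φᵀ * S * Φ -
    (fromRows (S * Φ) (0 : Matrix (Fin c) (Fin q) ℝ))ᵀ * (Kmat S C)⁻¹ *
      fromRows (S * Φ) (0 : Matrix (Fin c) (Fin q) ℝ)

end

/-- `S_Δ⁻¹` is symmetric whenever `S` is. -/
theorem SDelta_transpose {n c : ℕ} {S : Matrix (Fin n) (Fin n) ℝ} (hS : Sᵀ = S)
    (C : Matrix (Fin c) (Fin n) ℝ) : (SDelta S C)ᵀ = SDelta S C := by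
  have hK : (Kmat S C)ᵀ = Kmat S C := by
    simp [Kmat, fromBlocks_transpose, hS]
  have hKinv : ((Kmat S C)⁻¹)ᵀ = (Kmat S C)⁻¹ := by
    rw [transpose_nonsing_inv, hK]
  ext i j
  exact congrFun (congrFun hKinv (Sum.inl i)) (Sum.inl j)

/-- A solution `w` of the constrained problem `S w + Cᵀ μ = d`, `C w = 0` is `S_Δ⁻¹ d`. -/
theorem eq_SDelta_mulVec {n c : ℕ} {S : Matrix (Fin n) (Fin n) ℝ}
    {C : Matrix (Fin c) (Fin n) ℝ} (hK : IsUnit (Kmat S C))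
    {w d : Fin n → ℝ} {μ : Fin c → ℝ}
    (h : S.mulVec w + Cᵀ.mulVec μ = d) (hw : C.mulVec w = 0) :
    w = (SDelta S C).mulVec d := by
  have hsol : (Kmat S C).mulVec (Sum.elim w μ) = Sum.elim d 0 := by
    simp [Kmat, fromBlocks_mulVec, h, hw]
  have hinv : Sum.elim w μ = (Kmat S C)⁻¹.mulVec (Sum.elim d 0) := by
    rw [← hsol, mulVec_mulVec, nonsing_inv_mul _ ((isUnit_iff_isUnit_det _).mp hK), one_mulVec]
  rw [← fromBlocks_toBlocks (Kmat S C)⁻¹, fromBlocks_mulVec] at hinv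
  funext i
  simpa [SDelta] using congrFun hinv (Sum.inl i)

/-- The coarse matrix in terms of `S_Δ⁻¹`. -/
theorem Sc_eq {n c q : ℕ} {S : Matrix (Fin n) (Fin n) ℝ} (hS : Sᵀ = S)
    (C : Matrix (Fin c) (Fin n) ℝ) (Φ : Matrix (Fin n) (Fin q) ℝ) :
    Sc S C Φ = Φᵀ * S * Φ - Φᵀ * S * SDelta S C * (S * Φ) := by
  rw [Sc, ← fromBlocks_toBlocks (Kmat S C)⁻¹, transpose_fromRows, fromCols_mul_fromBlocks,
    fromCols_mul_fromRows]
  simp [SDelta, transpose_mul, hS]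

theorem stmt_18 {n c q k : ℕ} (hn : 0 < n) (hc : 0 < c) (hq : 0 < q) (hk : 0 < k)
    (S : Matrix (Fin n) (Fin n) ℝ) (hS : Sᵀ = S)
    (C : Matrix (Fin c) (Fin n) ℝ) (hK : IsUnit (Kmat S C))
    (Φ : Matrix (Fin n) (Fin q) ℝ) (R_c : Matrix (Fin c) (Fin q) ℝ) (hCΦ : C * Φ = R_c)
    (B : Matrix (Fin k) (Fin n) ℝ)
    (w : Fin n → ℝ) (μ : Fin c → ℝ) (u_c : Fin q → ℝ) (lam : Fin k → ℝ) (g : Fin n → ℝ)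
    (h1 : S.mulVec w + Cᵀ.mulVec μ + (S * Φ).mulVec u_c + Bᵀ.mulVec lam = g)
    (h2 : C.mulVec w = 0)
    (h3 : (Φᵀ * S).mulVec w + (Φᵀ * S * Φ).mulVec u_c + (Φᵀ * Bᵀ).mulVec lam =
      Φᵀ.mulVec g)
    (h4 : B.mulVec w + (B * Φ).mulVec u_c = 0) :
    (Sc S C Φ).mulVec u_c + ((Psi S C Φ)ᵀ * Bᵀ).mulVec lam = (Psi S C Φ)ᵀ.mulVec g ∧
      (B * Psi S C Φ).mulVec u_c - (B * SDelta S C * Bᵀ).mulVec lam =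
        -(B * SDelta S C).mulVec g := by
  have hw : w = (SDelta S C).mulVec (g - (S * Φ).mulVec u_c - Bᵀ.mulVec lam) :=
    eq_SDelta_mulVec hK (by rw [← h1]; abel) h2
  have hΨ : (Psi S C Φ)ᵀ = Φᵀ - Φᵀ * S * SDelta S C := by
    simp [Psi, transpose_mul, SDelta_transpose hS, hS, Matrix.mul_sub, Matrix.mul_assoc]
  rw [hw] at h3 h4
  constructor
  · rw [Sc_eq hS, hΨ]
    simp only [mulVec_sub, mulVec_mulVec, sub_mulVec, Matrix.sub_mul, Matrix.mul_assoc] at h3 ⊢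
    linear_combination h3
  · simp only [Psi, mulVec_sub, mulVec_mulVec, sub_mulVec, Matrix.sub_mul, Matrix.mul_sub,
      Matrix.one_mul, Matrix.mul_assoc] at h4 ⊢
    linear_combination h4
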